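/- arXiv:2409.09310 — 6 statements merged into one kernel-verified Lean document; each statement's English description precedes it below -/
import Mathlib

section
/- Let v_{α,δ} = δ − D Zᵀ R⁻¹ (α + Z δ) + D Zᵀ R⁻¹ (u − X β). Then for all u ∈ ℝⁿ, α ∈ ℝⁿ, β ∈ ℝᵖ, γ ∈ ℝʳ, δ ∈ ℝʳ, the Gaussian density factorization identity holds: φ(u; α + Xβ + Zγ, W⁻¹) · φ(γ; δ, D) = φ(γ; v_{α,δ}, V) · φ(u; α + Xβ + Zδ, R). -/
open Matrix MeasureTheory

/-- The multivariate Gaussian probability density of `N(a, A)` evaluated at `t`. -/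
noncomputable def gauss {ι : Type*} [Fintype ι] [DecidableEq ι]
    (t a : ι → ℝ) (A : Matrix ι ι ℝ) : ℝ :=
  (2 * Real.pi) ^ (-(Fintype.card ι : ℝ) / 2) * A.det ^ (-(1 : ℝ) / 2) *
    Real.exp (-(1 / 2) * ((t - a) ⬝ᵥ (A⁻¹ *ᵥ (t - a))))

section MarginalConditional

variable {m k : Type*} [Fintype m] [DecidableEq m] [Fintype k] [DecidableEq k]
  {Z : Matrix m k ℝ} {D V : Matrix k k ℝ} {W R : Matrix m m ℝ}

/-- The conditional precision times the gain matrix `D Zᵀ R⁻¹` is `Zᵀ W`. -/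
lemma precision_mul_gain (hD : IsUnit D.det) (hW : IsUnit W.det) (hRu : IsUnit R.det)
    (hR : R = W⁻¹ + Z * D * Zᵀ) :
    (D⁻¹ + Zᵀ * W * Z) * (D * Zᵀ * R⁻¹) = Zᵀ * W := by
  have hZ : Z * D * Zᵀ = R - W⁻¹ := by rw [hR]; abel
  calc (D⁻¹ + Zᵀ * W * Z) * (D * Zᵀ * R⁻¹)
      = (D⁻¹ * D) * Zᵀ * R⁻¹ + Zᵀ * W * (Z * D * Zᵀ) * R⁻¹ := by
        simp only [Matrix.add_mul, Matrix.mul_assoc]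
    _ = Zᵀ * R⁻¹ + (Zᵀ * W * (R * R⁻¹) - Zᵀ * (W * W⁻¹) * R⁻¹) := by
        rw [hZ, nonsing_inv_mul _ hD]
        simp only [Matrix.mul_sub, Matrix.sub_mul, Matrix.mul_assoc, Matrix.one_mul]
    _ = Zᵀ * W := by
        rw [mul_nonsing_inv _ hRu, mul_nonsing_inv _ hW]
        simp

lemma mul_gain (hW : IsUnit W.det) (hRu : IsUnit R.det) (hR : R = W⁻¹ + Z * D * Zᵀ) :
    W * Z * (D * Zᵀ * R⁻¹) = W - R⁻¹ := by
  have hZ : Z * D * Zᵀ = R - W⁻¹ := by rw [hR]; abel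
  calc W * Z * (D * Zᵀ * R⁻¹) = W * (Z * D * Zᵀ) * R⁻¹ := by
        simp only [Matrix.mul_assoc]
    _ = W * (R * R⁻¹) - (W * W⁻¹) * R⁻¹ := by
        rw [hZ]; simp only [Matrix.mul_sub, Matrix.sub_mul, Matrix.mul_assoc]
    _ = W - R⁻¹ := by
        rw [mul_nonsing_inv _ hRu, mul_nonsing_inv _ hW]; simp

/-- The conditional precision is inverse to the conditional covariance. -/
lemma precision_mul_covariance (hD : IsUnit D.det) (hW : IsUnit W.det) (hRu : IsUnit R.det)
    (hR : R = W⁻¹ + Z * D * Zᵀ) (hV : V = D - D * Zᵀ * R⁻¹ * Z * D) :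
    (D⁻¹ + Zᵀ * W * Z) * V = 1 := by
  have h : (D⁻¹ + Zᵀ * W * Z) * V =
      D⁻¹ * D + Zᵀ * W * Z * D -
        (D⁻¹ + Zᵀ * W * Z) * (D * Zᵀ * R⁻¹) * (Z * D) := by
    rw [hV, Matrix.mul_sub, Matrix.add_mul]
    simp only [Matrix.mul_assoc]
  rw [h, precision_mul_gain hD hW hRu hR, nonsing_inv_mul _ hD]
  simp only [Matrix.mul_assoc, add_sub_cancel_right]

lemma det_covariance_mul_det (hD : IsUnit D.det) (hW : IsUnit W.det) (hRu : IsUnit R.det)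
    (hR : R = W⁻¹ + Z * D * Zᵀ) (hV : V = D - D * Zᵀ * R⁻¹ * Z * D) :
    V.det * R.det = W⁻¹.det * D.det := by
  have hWR : W.det * R.det = (1 + Zᵀ * (W * Z * D)).det := by
    rw [det_one_add_mul_comm, ← det_mul, hR, Matrix.mul_add, mul_nonsing_inv _ hW]
    simp only [Matrix.mul_assoc]
  have hMD : (D⁻¹ + Zᵀ * W * Z).det * D.det = (1 + Zᵀ * (W * Z * D)).det := by
    rw [← det_mul, Matrix.add_mul, nonsing_inv_mul _ hD]
    simp only [Matrix.mul_assoc]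
  have hMV : (D⁻¹ + Zᵀ * W * Z).det * V.det = 1 := by
    rw [← det_mul, precision_mul_covariance hD hW hRu hR hV, det_one]
  have hWW : W⁻¹.det * W.det = 1 := by rw [← det_mul, nonsing_inv_mul _ hW, det_one]
  linear_combination (-V.det * R.det) * hWW + W⁻¹.det * V.det * (hWR - hMD) +
    W⁻¹.det * D.det * hMV

/-- Completing the square in the joint quadratic form. -/
lemma quadratic_form_completion (hDs : IsUnit D.det) (hDT : Dᵀ = D)
    (hW : IsUnit W.det) (hWT : Wᵀ = W) (hRu : IsUnit R.det)
    (hR : R = W⁻¹ + Z * D * Zᵀ) (e : m → ℝ) (d : k → ℝ) :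
    (e - Z *ᵥ d) ⬝ᵥ (W *ᵥ (e - Z *ᵥ d)) + d ⬝ᵥ (D⁻¹ *ᵥ d) =
      (d - (D * Zᵀ * R⁻¹) *ᵥ e) ⬝ᵥ
          ((D⁻¹ + Zᵀ * W * Z) *ᵥ (d - (D * Zᵀ * R⁻¹) *ᵥ e)) + e ⬝ᵥ (R⁻¹ *ᵥ e) := by
  have hMK := precision_mul_gain hDs hW hRu hR
  have hWK := mul_gain hW hRu hR
  have hMT : (D⁻¹ + Zᵀ * W * Z)ᵀ = D⁻¹ + Zᵀ * W * Z := by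
    simp [transpose_nonsing_inv, hDT, hWT, Matrix.mul_assoc]
  have hKM : (D * Zᵀ * R⁻¹)ᵀ * (D⁻¹ + Zᵀ * W * Z) = W * Z := by
    rw [← hMT, ← transpose_mul, hMK]; simp [hWT]
  have hMd : (D⁻¹ + Zᵀ * W * Z) *ᵥ (d - (D * Zᵀ * R⁻¹) *ᵥ e) =
      (D⁻¹ + Zᵀ * W * Z) *ᵥ d - (Zᵀ * W) *ᵥ e := by
    rw [mulVec_sub, mulVec_mulVec, hMK]
  have hK : ∀ x, ((D * Zᵀ * R⁻¹) *ᵥ e) ⬝ᵥ x = e ⬝ᵥ ((D * Zᵀ * R⁻¹)ᵀ *ᵥ x) := fun x => by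
    rw [mulVec_transpose, dotProduct_comm e, ← dotProduct_mulVec, dotProduct_comm]
  have hZd : ∀ x, (Z *ᵥ d) ⬝ᵥ x = d ⬝ᵥ (Zᵀ *ᵥ x) := fun x => by
    rw [mulVec_transpose, dotProduct_comm d, ← dotProduct_mulVec, dotProduct_comm]
  have hKq : ((D * Zᵀ * R⁻¹) *ᵥ e) ⬝ᵥ
      ((D⁻¹ + Zᵀ * W * Z) *ᵥ (d - (D * Zᵀ * R⁻¹) *ᵥ e)) =
      e ⬝ᵥ ((W * Z) *ᵥ d) - e ⬝ᵥ (W *ᵥ e) + e ⬝ᵥ (R⁻¹ *ᵥ e) := by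
    rw [hK, mulVec_mulVec, hKM, mulVec_sub, mulVec_mulVec, hWK, sub_mulVec,
      dotProduct_sub, dotProduct_sub]
    ring
  rw [sub_dotProduct d, hKq, hMd, sub_dotProduct e, hZd]
  simp only [mulVec_sub, mulVec_mulVec, add_mulVec, dotProduct_sub, dotProduct_add,
    Matrix.mul_assoc]
  ring

end MarginalConditional

/-- Gaussian density factorization identity (Lemma 1 of the paper). -/
theorem stmt_0 (n p r : ℕ) (hn : 0 < n) (hp : 0 < p) (hr : 0 < r)
    (X : Matrix (Fin n) (Fin p) ℝ) (Z : Matrix (Fin n) (Fin r) ℝ)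
    (D : Matrix (Fin r) (Fin r) ℝ) (hD : D.PosDef)
    (W : Matrix (Fin n) (Fin n) ℝ) (hWdiag : W.IsDiag) (hWpos : ∀ i, 0 < W i i)
    (R : Matrix (Fin n) (Fin n) ℝ) (hR : R = W⁻¹ + Z * D * Zᵀ)
    (V : Matrix (Fin r) (Fin r) ℝ) (hV : V = D - D * Zᵀ * R⁻¹ * Z * D) :
    ∀ (u α : Fin n → ℝ) (β : Fin p → ℝ) (γ δ : Fin r → ℝ),
      gauss u (α + X *ᵥ β + Z *ᵥ γ) W⁻¹ * gauss γ δ D =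
        gauss γ
            (δ - (D * Zᵀ * R⁻¹) *ᵥ (α + Z *ᵥ δ) + (D * Zᵀ * R⁻¹) *ᵥ (u - X *ᵥ β)) V *
          gauss u (α + X *ᵥ β + Z *ᵥ δ) R := by
  intro u α β γ δ
  have hWp : W.PosDef := by
    rw [← hWdiag.diagonal_diag]
    exact PosDef.diagonal hWpos
  have hRp : R.PosDef := by
    rw [hR]
    refine hWp.inv.add_posSemidef ?_
    simpa using hD.posSemidef.mul_mul_conjTranspose_same Z
  have hDu := hD.det_pos.ne'.isUnit
  have hWu := hWp.det_pos.ne'.isUnit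
  have hRu := hRp.det_pos.ne'.isUnit
  have hdet := det_covariance_mul_det hDu hWu hRu hR hV
  have hVpos : 0 < V.det := by
    refine pos_of_mul_pos_left ?_ hRp.det_pos.le
    rw [hdet]
    exact mul_pos hWp.inv.det_pos hD.det_pos
  have hVinv : V⁻¹ = D⁻¹ + Zᵀ * W * Z :=
    inv_eq_left_inv (precision_mul_covariance hDu hWu hRu hR hV)
  have hq := quadratic_form_completion hDu (by simpa using hD.isHermitian.eq) hWu
    (by simpa using hWp.isHermitian.eq) hRu hR
    (u - (α + X *ᵥ β + Z *ᵥ δ)) (γ - δ)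
  have he : u - (α + X *ᵥ β + Z *ᵥ δ) - Z *ᵥ (γ - δ) = u - (α + X *ᵥ β + Z *ᵥ γ) := by
    rw [mulVec_sub]; abel
  have hd : γ - δ - (D * Zᵀ * R⁻¹) *ᵥ (u - (α + X *ᵥ β + Z *ᵥ δ)) =
      γ - (δ - (D * Zᵀ * R⁻¹) *ᵥ (α + Z *ᵥ δ) +
        (D * Zᵀ * R⁻¹) *ᵥ (u - X *ᵥ β)) := by
    simp only [mulVec_sub, mulVec_add]; abel
  rw [he, hd, ← hVinv] at hq
  have hrpow : W⁻¹.det ^ (-(1 : ℝ) / 2) * D.det ^ (-(1 : ℝ) / 2) =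
      V.det ^ (-(1 : ℝ) / 2) * R.det ^ (-(1 : ℝ) / 2) := by
    rw [← Real.mul_rpow hWp.inv.det_pos.le hD.det_pos.le,
      ← Real.mul_rpow hVpos.le hRp.det_pos.le, hdet]
  unfold gauss
  rw [nonsing_inv_nonsing_inv _ hWu, mul_mul_mul_comm, mul_mul_mul_comm _ (W⁻¹.det ^ _),
    hrpow, ← Real.exp_add, ← mul_add, hq, mul_add, Real.exp_add]
  ring
end

section
/- The identity (I_r − Zᵀ R⁻¹ Z D) V⁻¹ = D⁻¹ holds, where V⁻¹ denotes the inverse of V = D − D Zᵀ R⁻¹ Z D and I_r is the r×r identity matrix. -/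
open Matrix

/-- A diagonal real matrix with positive diagonal entries is positive definite. -/
theorem Matrix.IsDiag.posDef_of_pos {n : Type*} [Fintype n] [DecidableEq n] {W : Matrix n n ℝ}
    (hW : W.IsDiag) (hpos : ∀ i, 0 < W i i) : W.PosDef := by
  rw [← hW.diagonal_diag]
  exact Matrix.PosDef.diagonal hpos

/-- If `R = W⁻¹ + Z D Y` with `R` and `W` invertible, then `1 + Y W Z D` is a right inverse of
`1 - Y R⁻¹ Z D`. -/
theorem Matrix.one_sub_mul_one_add_eq_one {n r K : Type*} [Fintype n] [DecidableEq n] [Fintype r]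
    [DecidableEq r] [CommRing K] {W R : Matrix n n K} {Z : Matrix n r K} {Y : Matrix r n K}
    {D : Matrix r r K} (hR : R = W⁻¹ + Z * D * Y) (hRu : IsUnit R.det) (hWu : IsUnit W.det) :
    (1 - Y * R⁻¹ * Z * D) * (1 + Y * W * Z * D) = 1 := by
  have key : R⁻¹ * (Z * D * Y) * W = W - R⁻¹ := by
    rw [eq_sub_of_add_eq' hR.symm, Matrix.mul_sub, Matrix.sub_mul, Matrix.nonsing_inv_mul _ hRu,
      Matrix.one_mul, Matrix.mul_assoc, Matrix.nonsing_inv_mul _ hWu, Matrix.mul_one]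
  have h : Y * R⁻¹ * Z * D * (Y * W * Z * D) = Y * W * Z * D - Y * R⁻¹ * Z * D := by
    calc Y * R⁻¹ * Z * D * (Y * W * Z * D) = Y * (R⁻¹ * (Z * D * Y) * W) * Z * D := by
          simp only [Matrix.mul_assoc]
      _ = _ := by rw [key]; simp only [Matrix.mul_sub, Matrix.sub_mul]
  rw [Matrix.sub_mul, Matrix.one_mul, Matrix.mul_add, Matrix.mul_one, h]
  abel

/-- The identity `(I_r − Zᵀ R⁻¹ Z D) V⁻¹ = D⁻¹`. -/
theorem stmt_4 (n p r : ℕ) (hn : 0 < n) (hp : 0 < p) (hr : 0 < r)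
    (X : Matrix (Fin n) (Fin p) ℝ) (Z : Matrix (Fin n) (Fin r) ℝ)
    (D : Matrix (Fin r) (Fin r) ℝ) (hD : D.PosDef)
    (W : Matrix (Fin n) (Fin n) ℝ) (hWdiag : W.IsDiag) (hWpos : ∀ i, 0 < W i i)
    (R : Matrix (Fin n) (Fin n) ℝ) (hR : R = W⁻¹ + Z * D * Zᵀ)
    (V : Matrix (Fin r) (Fin r) ℝ) (hV : V = D - D * Zᵀ * R⁻¹ * Z * D) :
    (1 - Zᵀ * R⁻¹ * Z * D) * V⁻¹ = D⁻¹ := by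
  have hW : W.PosDef := hWdiag.posDef_of_pos hWpos
  have hZ : (Z * D * Zᵀ).PosSemidef := by
    simpa using hD.posSemidef.mul_mul_conjTranspose_same Z
  have hRpos : R.PosDef := hR ▸ hW.inv.add_posSemidef hZ
  have hA := Matrix.one_sub_mul_one_add_eq_one hR ((Matrix.isUnit_iff_isUnit_det _).1 hRpos.isUnit)
    ((Matrix.isUnit_iff_isUnit_det _).1 hW.isUnit)
  have hVA : V = D * (1 - Zᵀ * R⁻¹ * Z * D) := by
    rw [hV, Matrix.mul_sub, Matrix.mul_one]
    simp only [Matrix.mul_assoc]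
  rw [hVA, Matrix.mul_inv_rev,
    Matrix.mul_nonsing_inv_cancel_left _ _ (Matrix.isUnit_det_of_right_inverse hA)]
end

section
/- The identity Zᵀ R⁻¹ Z + (I_r − Zᵀ R⁻¹ Z D) V⁻¹ (I_r − D Zᵀ R⁻¹ Z) = D⁻¹ holds, where V⁻¹ denotes the inverse of V = D − D Zᵀ R⁻¹ Z D and I_r is the r×r identity matrix. -/
open Matrix

/-- The Woodbury identity: `D - D Zᵀ R⁻¹ Z D` is a left inverse of `D⁻¹ + Zᵀ W Z`
when `R = W⁻¹ + Z D Zᵀ`. -/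
theorem Matrix.woodbury_mul_eq_one {m n K : Type*} [Fintype m] [DecidableEq m]
    [Fintype n] [DecidableEq n] [CommRing K] (Z : Matrix n m K) (D : Matrix m m K)
    (W : Matrix n n K) (hD : IsUnit D.det) (hW : IsUnit W.det)
    (hR : IsUnit (W⁻¹ + Z * D * Zᵀ).det) :
    (D - D * Zᵀ * (W⁻¹ + Z * D * Zᵀ)⁻¹ * Z * D) * (D⁻¹ + Zᵀ * W * Z) = 1 := by
  have hDD := mul_nonsing_inv D hD
  have hRW : Z * D * Zᵀ * W = (W⁻¹ + Z * D * Zᵀ) * W - 1 := by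
    rw [add_mul, nonsing_inv_mul W hW, add_sub_cancel_left]
  have hRR := nonsing_inv_mul _ hR
  generalize W⁻¹ + Z * D * Zᵀ = R at *
  calc (D - D * Zᵀ * R⁻¹ * Z * D) * (D⁻¹ + Zᵀ * W * Z)
      = D * D⁻¹ - D * Zᵀ * R⁻¹ * Z * (D * D⁻¹) + D * Zᵀ * W * Z
          - D * Zᵀ * R⁻¹ * (Z * D * Zᵀ * W) * Z := by
        simp only [Matrix.sub_mul, Matrix.mul_add, Matrix.mul_assoc]
        abel
    _ = 1 - D * Zᵀ * R⁻¹ * Z + D * Zᵀ * W * Z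
          - (D * Zᵀ * (R⁻¹ * R) * W * Z - D * Zᵀ * R⁻¹ * Z) := by
        rw [hDD, hRW]
        simp only [Matrix.sub_mul, Matrix.mul_sub, Matrix.mul_assoc, Matrix.mul_one]
    _ = 1 := by
        rw [hRR, Matrix.mul_one]
        abel

/-- If `D` and `D - D A D` are invertible, then
`A + (1 - A D) (D - D A D)⁻¹ (1 - D A) = D⁻¹`. -/
theorem Matrix.add_mul_inv_sub_mul_eq_inv {m K : Type*} [Fintype m] [DecidableEq m]
    [CommRing K] (A D : Matrix m m K) (hD : IsUnit D.det)
    (hV : IsUnit (D - D * A * D).det) :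
    A + (1 - A * D) * (D - D * A * D)⁻¹ * (1 - D * A) = D⁻¹ := by
  have hDD := mul_nonsing_inv D hD
  have hDD' := nonsing_inv_mul D hD
  have hleft : 1 - A * D = D⁻¹ * (D - D * A * D) := by
    rw [Matrix.mul_sub, Matrix.mul_assoc D, ← Matrix.mul_assoc D⁻¹ D, hDD', Matrix.one_mul]
  have hright : (D - D * A * D) * D⁻¹ = 1 - D * A := by
    rw [Matrix.sub_mul, Matrix.mul_assoc (D * A), hDD, Matrix.mul_one]
  rw [hleft, Matrix.mul_assoc D⁻¹, mul_nonsing_inv _ hV, Matrix.mul_one, ← hright,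
    ← Matrix.mul_assoc, ← hleft, Matrix.sub_mul, Matrix.mul_assoc A, hDD, Matrix.mul_one,
    Matrix.one_mul, add_sub_cancel]

/-- The identity `Zᵀ R⁻¹ Z + (I_r − Zᵀ R⁻¹ Z D) V⁻¹ (I_r − D Zᵀ R⁻¹ Z) = D⁻¹`. -/
theorem stmt_5 (n p r : ℕ) (hn : 0 < n) (hp : 0 < p) (hr : 0 < r)
    (X : Matrix (Fin n) (Fin p) ℝ) (Z : Matrix (Fin n) (Fin r) ℝ)
    (D : Matrix (Fin r) (Fin r) ℝ) (hD : D.PosDef)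
    (W : Matrix (Fin n) (Fin n) ℝ) (hWdiag : W.IsDiag) (hWpos : ∀ i, 0 < W i i)
    (R : Matrix (Fin n) (Fin n) ℝ) (hR : R = W⁻¹ + Z * D * Zᵀ)
    (V : Matrix (Fin r) (Fin r) ℝ) (hV : V = D - D * Zᵀ * R⁻¹ * Z * D) :
    Zᵀ * R⁻¹ * Z + (1 - Zᵀ * R⁻¹ * Z * D) * V⁻¹ * (1 - D * Zᵀ * R⁻¹ * Z) = D⁻¹ := by
  have hW := hWdiag.posDef_of_pos hWpos
  have hRpos : (W⁻¹ + Z * D * Zᵀ).PosDef := by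
    refine hW.inv.add_posSemidef ?_
    simpa using hD.posSemidef.mul_mul_conjTranspose_same Z
  have hVunit : IsUnit V.det := by
    rw [hV, hR]
    exact isUnit_det_of_right_inverse (woodbury_mul_eq_one Z D W
      hD.det_pos.ne'.isUnit hW.det_pos.ne'.isUnit hRpos.det_pos.ne'.isUnit)
  have hV' : V = D - D * (Zᵀ * R⁻¹ * Z) * D := by
    simpa only [Matrix.mul_assoc] using hV
  rw [hV'] at hVunit ⊢
  simpa only [Matrix.mul_assoc] using
    add_mul_inv_sub_mul_eq_inv (Zᵀ * R⁻¹ * Z) D hD.det_pos.ne'.isUnit hVunit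
end

section
/- Under the GLMM, the function h(α) = E{log[f_α(y|γ) π(γ)]} satisfies h(α) − h(0) = Σ_{i=1}^n ∫_{ℝʳ} [b'(η_i(γ)) α_i − b(η_i(γ) + α_i) + b(η_i(γ))] φ(γ; 0, D) dγ, and consequently h(α) < h(0) for every α ∈ ℝⁿ with α ≠ 0, provided each function γ ↦ b(η_i(γ) + α_i) − b(η_i(γ)) − α_i b'(η_i(γ)) is integrable with respect to the N(0, D) measure and h(0) is finite. -/
open Matrix MeasureTheory

theorem gauss_pos {ι : Type*} [Fintype ι] [DecidableEq ι] (t a : ι → ℝ) {A : Matrix ι ι ℝ}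
    (hA : A.PosDef) : 0 < gauss t a A := by
  have := Real.rpow_pos_of_pos hA.det_pos (-(1 : ℝ) / 2)
  unfold gauss
  positivity

/-- The graph of a function with positive second derivative lies strictly above its tangent
lines, away from the point of tangency. -/
theorem add_mul_deriv_lt_of_deriv2_pos {b : ℝ → ℝ} (hb : Differentiable ℝ b)
    (hb'' : ∀ t, 0 < deriv (deriv b) t) (x : ℝ) {a : ℝ} (ha : a ≠ 0) :
    b x + a * deriv b x < b (x + a) := by
  have hconv : StrictConvexOn ℝ Set.univ b :=
    strictConvexOn_univ_of_deriv2_pos hb.continuous fun t => hb'' t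
  rcases lt_or_gt_of_ne ha with ha | ha
  · have := hconv.slope_lt_of_hasDerivAt (Set.mem_univ (x + a)) (Set.mem_univ x)
      (by linarith) (hb x).hasDerivAt
    rw [slope_def_field, div_lt_iff₀ (by linarith)] at this
    linarith
  · have := hconv.lt_slope_of_hasDerivAt (Set.mem_univ x) (Set.mem_univ (x + a))
      (by linarith) (hb x).hasDerivAt
    rw [slope_def_field, lt_div_iff₀ (by linarith)] at this
    linarith

/-- In the GLMM, `h(α) = E log[f_α(y|γ) π(γ)]` satisfies
`h(α) − h(0) = Σᵢ ∫ [b'(ηᵢ(γ)) αᵢ − b(ηᵢ(γ) + αᵢ) + b(ηᵢ(γ))] φ(γ; 0, D) dγ`,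
and consequently `h(α) < h(0)` for every `α ≠ 0`. -/
theorem stmt_10 (n p r : ℕ) (hn : 0 < n) (hp : 0 < p) (hr : 0 < r)
    (X : Matrix (Fin n) (Fin p) ℝ) (Z : Matrix (Fin n) (Fin r) ℝ)
    (β : Fin p → ℝ) (D : Matrix (Fin r) (Fin r) ℝ) (hD : D.PosDef)
    (η : (Fin r → ℝ) → Fin n → ℝ) (hη : ∀ γ, η γ = X *ᵥ β + Z *ᵥ γ)
    (b : ℝ → ℝ) (hb : ContDiff ℝ 2 b) (hb'' : ∀ t, 0 < deriv (deriv b) t)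
    (ν : Measure (Fin n → ℝ)) [SigmaFinite ν] (c : ℝ → ℝ)
    (f : (Fin n → ℝ) → (Fin r → ℝ) → ℝ)
    (hf : ∀ y γ, f y γ =
      Real.exp (y ⬝ᵥ η γ - ∑ i, b (η γ i) + ∑ i, c (y i)))
    (hfprob : ∀ γ, ∫ y, f y γ ∂ν = 1)
    (hfint : ∀ γ, Integrable (fun y => f y γ) ν)
    (hfmean : ∀ γ i, ∫ y, y i * f y γ ∂ν = deriv b (η γ i))
    (hfmean_int : ∀ γ i, Integrable (fun y => y i * f y γ) ν)
    (fα : (Fin n → ℝ) → (Fin n → ℝ) → (Fin r → ℝ) → ℝ)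
    (hfα : ∀ α y γ, fα α y γ =
      Real.exp (y ⬝ᵥ (η γ + α) - ∑ i, b (η γ i + α i) + ∑ i, c (y i)))
    (h : (Fin n → ℝ) → ℝ)
    (hh : ∀ α, h α =
      ∫ γ, (∫ y, Real.log (fα α y γ * gauss γ 0 D) * f y γ ∂ν) * gauss γ 0 D)
    -- `h(0)` is finite:
    (hfin_inner : ∀ γ,
      Integrable (fun y => Real.log (fα 0 y γ * gauss γ 0 D) * f y γ) ν)
    (hfin_outer : Integrable (fun γ : Fin r → ℝ =>
      (∫ y, Real.log (fα 0 y γ * gauss γ 0 D) * f y γ ∂ν) * gauss γ 0 D))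
    (α : Fin n → ℝ)
    -- each `γ ↦ b(ηᵢ(γ) + αᵢ) − b(ηᵢ(γ)) − αᵢ b'(ηᵢ(γ))` is `N(0, D)`-integrable:
    (hint : ∀ i, Integrable (fun γ : Fin r → ℝ =>
      (b (η γ i + α i) - b (η γ i) - α i * deriv b (η γ i)) * gauss γ 0 D)) :
    (h α - h 0 = ∑ i, ∫ γ,
        (deriv b (η γ i) * α i - b (η γ i + α i) + b (η γ i)) * gauss γ 0 D) ∧
      (α ≠ 0 → h α < h 0) := by
  have hg : ∀ γ, 0 < gauss γ 0 D := fun γ => gauss_pos γ 0 hD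
  have hlog : ∀ y γ, Real.log (fα α y γ * gauss γ 0 D) * f y γ =
      Real.log (fα 0 y γ * gauss γ 0 D) * f y γ +
        ∑ i, (α i * (y i * f y γ) - (b (η γ i + α i) - b (η γ i)) * f y γ) := by
    intro y γ
    have hsum : ∑ i, (α i * (y i * f y γ) - (b (η γ i + α i) - b (η γ i)) * f y γ) =
        (y ⬝ᵥ α - ∑ i, b (η γ i + α i) + ∑ i, b (η γ i)) * f y γ := by
      rw [dotProduct, ← Finset.sum_sub_distrib, ← Finset.sum_add_distrib, Finset.sum_mul]
      exact Finset.sum_congr rfl fun i _ => by ring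
    rw [hsum, hfα, hfα, Real.log_mul (Real.exp_pos _).ne' (hg γ).ne',
      Real.log_mul (Real.exp_pos _).ne' (hg γ).ne', Real.log_exp, Real.log_exp, dotProduct_add]
    simp only [add_zero, Pi.zero_apply]
    ring
  have hterm_int : ∀ γ i, Integrable
      (fun y => α i * (y i * f y γ) - (b (η γ i + α i) - b (η γ i)) * f y γ) ν :=
    fun γ i => ((hfmean_int γ i).const_mul _).sub ((hfint γ).const_mul _)
  have hinner : ∀ γ, ∫ y, Real.log (fα α y γ * gauss γ 0 D) * f y γ ∂ν =
      ∫ y, Real.log (fα 0 y γ * gauss γ 0 D) * f y γ ∂ν +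
        ∑ i, (deriv b (η γ i) * α i - b (η γ i + α i) + b (η γ i)) := by
    intro γ
    simp_rw [hlog]
    rw [integral_add (hfin_inner γ) (integrable_finsetSum _ fun i _ => hterm_int γ i),
      integral_finsetSum _ fun i _ => hterm_int γ i]
    congr 1
    refine Finset.sum_congr rfl fun i _ => ?_
    rw [integral_sub ((hfmean_int γ i).const_mul _) ((hfint γ).const_mul _),
      integral_const_mul, integral_const_mul, hfmean, hfprob]
    ring
  have hint' : ∀ i, Integrable fun γ : Fin r → ℝ =>
      (deriv b (η γ i) * α i - b (η γ i + α i) + b (η γ i)) * gauss γ 0 D :=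
    fun i => (hint i).neg.congr (.of_forall fun γ => by simp only [Pi.neg_apply]; ring)
  have hdiff : h α - h 0 = ∑ i, ∫ γ,
      (deriv b (η γ i) * α i - b (η γ i + α i) + b (η γ i)) * gauss γ 0 D := by
    have hsplit : ∀ γ, (∫ y, Real.log (fα α y γ * gauss γ 0 D) * f y γ ∂ν) * gauss γ 0 D =
        (∫ y, Real.log (fα 0 y γ * gauss γ 0 D) * f y γ ∂ν) * gauss γ 0 D +
          ∑ i, (deriv b (η γ i) * α i - b (η γ i + α i) + b (η γ i)) * gauss γ 0 D :=
      fun γ => by rw [hinner, add_mul, Finset.sum_mul]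
    rw [hh α, hh 0, integral_congr_ae (.of_forall hsplit),
      integral_add hfin_outer (integrable_finsetSum _ fun i _ => hint' i),
      integral_finsetSum _ fun i _ => hint' i, add_sub_cancel_left]
  refine ⟨hdiff, fun hα => ?_⟩
  obtain ⟨j, hj⟩ := Function.ne_iff.mp hα
  have hneg : ∀ i, α i ≠ 0 → ∀ γ,
      (deriv b (η γ i) * α i - b (η γ i + α i) + b (η γ i)) * gauss γ 0 D < 0 := by
    intro i hi γ
    have := add_mul_deriv_lt_of_deriv2_pos (hb.differentiable (by norm_num)) hb'' (η γ i) hi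
    exact mul_neg_of_neg_of_pos (by linarith) (hg γ)
  rw [← sub_neg, hdiff]
  refine Finset.sum_neg' (fun i _ => ?_) ⟨j, Finset.mem_univ j, ?_⟩
  · refine integral_nonpos fun γ => ?_
    by_cases hi : α i = 0
    · simp [hi]
    · exact (hneg i hi γ).le
  · rw [← neg_pos, ← integral_neg, integral_pos_iff_support_of_nonneg
      (fun γ => (neg_pos.mpr (hneg j hj γ)).le) (hint' j).neg,
      Set.eq_univ_of_forall fun γ =>
        Function.mem_support.mpr (neg_pos.mpr (hneg j hj γ)).ne']
    exact Measure.measure_univ_pos.mpr (NeZero.ne _)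
end

section
/- Under the stated domination hypotheses, the function h is differentiable in the i-th coordinate and ∂h(α)/∂α_i = ∫_{ℝʳ} ∫_{ℝⁿ} [y_i − b'(η_i(γ) + α_i)] f(y|γ) π(γ) dν(y) dγ; equivalently, ∂h(α)/∂α_i = ∫_{ℝʳ} [b'(η_i(γ)) − b'(η_i(γ) + α_i)] φ(γ; 0, D) dγ. -/
open Matrix MeasureTheory

theorem continuous_gauss {ι : Type*} [Fintype ι] [DecidableEq ι] (a : ι → ℝ)
    (A : Matrix ι ι ℝ) : Continuous fun t => gauss t a A := by
  unfold gauss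
  have hq : Continuous fun t : ι → ℝ => (t - a) ⬝ᵥ (A⁻¹ *ᵥ (t - a)) :=
    Continuous.dotProduct (by fun_prop) (Continuous.matrix_mulVec (by fun_prop) (by fun_prop))
  fun_prop

/-- Under the stated domination hypotheses, `h` is differentiable in the `i`-th
coordinate with `∂h(α)/∂αᵢ = ∫∫ [yᵢ − b'(ηᵢ(γ) + αᵢ)] f(y|γ) π(γ) dν(y) dγ`;
equivalently `∂h(α)/∂αᵢ = ∫ [b'(ηᵢ(γ)) − b'(ηᵢ(γ) + αᵢ)] φ(γ; 0, D) dγ`. -/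
theorem stmt_11 (n p r : ℕ) (hn : 0 < n) (hp : 0 < p) (hr : 0 < r)
    (X : Matrix (Fin n) (Fin p) ℝ) (Z : Matrix (Fin n) (Fin r) ℝ)
    (β : Fin p → ℝ) (D : Matrix (Fin r) (Fin r) ℝ) (hD : D.PosDef)
    (η : (Fin r → ℝ) → Fin n → ℝ) (hη : ∀ γ, η γ = X *ᵥ β + Z *ᵥ γ)
    (b : ℝ → ℝ) (hb : ContDiff ℝ 2 b) (hb'' : ∀ t, 0 < deriv (deriv b) t)
    (ν : Measure (Fin n → ℝ)) [SigmaFinite ν] (c : ℝ → ℝ)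
    (f : (Fin n → ℝ) → (Fin r → ℝ) → ℝ)
    (hf : ∀ y γ, f y γ =
      Real.exp (y ⬝ᵥ η γ - ∑ i, b (η γ i) + ∑ i, c (y i)))
    (hfprob : ∀ γ, ∫ y, f y γ ∂ν = 1)
    (hfint : ∀ γ, Integrable (fun y => f y γ) ν)
    (hfmean : ∀ γ i, ∫ y, y i * f y γ ∂ν = deriv b (η γ i))
    (hfmean_int : ∀ γ i, Integrable (fun y => y i * f y γ) ν)
    (fα : (Fin n → ℝ) → (Fin n → ℝ) → (Fin r → ℝ) → ℝ)
    (hfα : ∀ α y γ, fα α y γ =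
      Real.exp (y ⬝ᵥ (η γ + α) - ∑ i, b (η γ i + α i) + ∑ i, c (y i)))
    (h : (Fin n → ℝ) → ℝ)
    (hh : ∀ α, h α =
      ∫ γ, (∫ y, Real.log (fα α y γ * gauss γ 0 D) * f y γ ∂ν) * gauss γ 0 D)
    -- domination hypotheses: locally uniform `N(0, D)`-integrable bounds for
    -- `b` and `b'` composed with shifted linear components:
    (hdom : ∀ (α : Fin n → ℝ) (i : Fin n), ∃ ε > 0, ∃ g : (Fin r → ℝ) → ℝ,
      Integrable (fun γ : Fin r → ℝ => g γ * gauss γ 0 D) ∧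
        ∀ (γ : Fin r → ℝ) (t : ℝ), |t - α i| < ε →
          |deriv b (η γ i + t)| ≤ g γ ∧ |b (η γ i + t)| ≤ g γ)
    -- all relevant integrals are finite:
    (hfin_inner : ∀ α γ,
      Integrable (fun y => Real.log (fα α y γ * gauss γ 0 D) * f y γ) ν)
    (hfin_outer : ∀ α, Integrable (fun γ : Fin r → ℝ =>
      (∫ y, Real.log (fα α y γ * gauss γ 0 D) * f y γ ∂ν) * gauss γ 0 D)) :
    ∀ (α : Fin n → ℝ) (i : Fin n),
      HasDerivAt (fun t => h (Function.update α i t))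
        (∫ γ, (∫ y, (y i - deriv b (η γ i + α i)) * f y γ ∂ν) * gauss γ 0 D)
        (α i) ∧
      (∫ γ, (∫ y, (y i - deriv b (η γ i + α i)) * f y γ ∂ν) * gauss γ 0 D) =
        ∫ γ, (deriv b (η γ i) - deriv b (η γ i + α i)) * gauss γ 0 D := by
  intro α i
  have hG : ∀ γ, 0 < gauss γ 0 D := fun γ => gauss_pos γ 0 hD
  have hGc : Continuous fun γ : Fin r → ℝ => gauss γ 0 D := continuous_gauss 0 D
  have hηc : Continuous fun γ => η γ i := by
    have : Continuous η := by
      rw [funext hη]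
      exact continuous_const.add (Continuous.matrix_mulVec continuous_const continuous_id)
    exact (continuous_apply i).comp this
  have hbd : Differentiable ℝ b := hb.differentiable (by norm_num)
  have hb'c : Continuous (deriv b) := hb.continuous_deriv (by norm_num)
  have hscore : ∀ γ, ∫ y, (y i - deriv b (η γ i + α i)) * f y γ ∂ν =
      deriv b (η γ i) - deriv b (η γ i + α i) := by
    intro γ
    simp only [sub_mul]
    rw [integral_sub (hfmean_int γ i) ((hfint γ).const_mul _), integral_const_mul,
      hfmean, hfprob, mul_one]
  have hlog : ∀ t y γ,
      Real.log (fα (Function.update α i t) y γ * gauss γ 0 D) =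
        Real.log (fα α y γ * gauss γ 0 D) +
          (y i * (t - α i) - (b (η γ i + t) - b (η γ i + α i))) := by
    intro t y γ
    have hdot : y ⬝ᵥ (η γ + Function.update α i t) = y ⬝ᵥ (η γ + α) + y i * (t - α i) := by
      have hu : Function.update α i t = α + Pi.single i (t - α i) := by
        ext j
        rcases eq_or_ne j i with rfl | hj <;> simp [*]
      rw [hu, ← add_assoc, dotProduct_add y (η γ + α), dotProduct_single]
    have hsum : ∑ j, b (η γ j + Function.update α i t j) =
        ∑ j, b (η γ j + α j) + (b (η γ i + t) - b (η γ i + α i)) := by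
      rw [← sub_eq_iff_eq_add', ← Finset.sum_sub_distrib, Finset.sum_eq_single i]
      · simp
      · intro j _ hj
        simp [hj]
      · simp
    rw [hfα, hfα, Real.log_mul (Real.exp_ne_zero _) (hG γ).ne',
      Real.log_mul (Real.exp_ne_zero _) (hG γ).ne', Real.log_exp, Real.log_exp, hdot, hsum]
    ring
  have hinner : ∀ t γ,
      ∫ y, Real.log (fα (Function.update α i t) y γ * gauss γ 0 D) * f y γ ∂ν =
        (∫ y, Real.log (fα α y γ * gauss γ 0 D) * f y γ ∂ν) +
          (deriv b (η γ i) * (t - α i) - (b (η γ i + t) - b (η γ i + α i))) := by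
    intro t γ
    have hsplit : ∀ y, Real.log (fα (Function.update α i t) y γ * gauss γ 0 D) * f y γ =
        Real.log (fα α y γ * gauss γ 0 D) * f y γ +
          ((t - α i) * (y i * f y γ) - (b (η γ i + t) - b (η γ i + α i)) * f y γ) := by
      intro y
      rw [hlog]
      ring
    simp only [hsplit]
    have hy := (hfmean_int γ i).const_mul (t - α i)
    have hc := (hfint γ).const_mul (b (η γ i + t) - b (η γ i + α i))
    refine (integral_add (hfin_inner α γ) (hy.sub hc)).trans (congrArg _ ?_)
    refine (integral_sub hy hc).trans ?_
    rw [integral_const_mul, integral_const_mul, hfmean, hfprob]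
    ring
  have hsecond : (∫ γ, (∫ y, (y i - deriv b (η γ i + α i)) * f y γ ∂ν) * gauss γ 0 D) =
      ∫ γ, (deriv b (η γ i) - deriv b (η γ i + α i)) * gauss γ 0 D := by
    simp only [hscore]
  refine ⟨?_, hsecond⟩
  rw [hsecond]
  obtain ⟨ε, hε, g, hg, hgb⟩ := hdom α i
  obtain ⟨ε₀, hε₀, g₀, hg₀, hgb₀⟩ := hdom 0 i
  simp only [hh]
  refine (hasDerivAt_integral_of_dominated_loc_of_deriv_le
    (F' := fun t γ => (deriv b (η γ i) - deriv b (η γ i + t)) * gauss γ 0 D)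
    (bound := fun γ => g₀ γ * gauss γ 0 D + g γ * gauss γ 0 D)
    (Metric.ball_mem_nhds (α i) hε)
    (Filter.Eventually.of_forall fun t => (hfin_outer _).aestronglyMeasurable)
    (hfin_outer _) ?_ ?_ (hg₀.add hg) ?_).2
  · have : Continuous fun γ => (deriv b (η γ i) - deriv b (η γ i + α i)) * gauss γ 0 D := by
      fun_prop
    exact this.aestronglyMeasurable
  · refine Filter.Eventually.of_forall fun γ t ht => ?_
    have h₀ : |deriv b (η γ i)| ≤ g₀ γ := by
      simpa using (hgb₀ γ 0 (by simpa using hε₀)).1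
    have h₁ := (hgb γ t (by simpa [Real.dist_eq] using ht)).1
    rw [Real.norm_eq_abs, abs_mul, abs_of_pos (hG γ), ← add_mul]
    exact mul_le_mul_of_nonneg_right ((abs_sub _ _).trans (add_le_add h₀ h₁)) (hG γ).le
  · refine Filter.Eventually.of_forall fun γ t _ => ?_
    simp only [hinner]
    have hbt : HasDerivAt (fun t => b (η γ i + t)) (deriv b (η γ i + t)) t :=
      (hbd _).hasDerivAt.comp_const_add _ _
    have hlin : HasDerivAt (fun t => deriv b (η γ i) * (t - α i)) (deriv b (η γ i)) t := by
      simpa using ((hasDerivAt_id t).sub_const (α i)).const_mul (deriv b (η γ i))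
    exact ((hlin.sub (hbt.sub_const _)).const_add _).mul_const _
end

section
/- Under the stated domination hypotheses, the Hessian matrix of h at any α ∈ ℝⁿ is diagonal with entries ∂²h(α)/∂α_i² = −∫_{ℝʳ} b''(η_i(γ) + α_i) φ(γ; 0, D) dγ < 0 and ∂²h(α)/∂α_i ∂α_j = 0 for i ≠ j; in particular the Hessian of h is negative definite at every α, and α = 0 is the unique maximizer of h, i.e., h(0) > h(α) for all α ≠ 0. -/
open Matrix MeasureTheory

theorem integral_pos_of_pos {Ω : Type*} [MeasurableSpace Ω] {μ : Measure Ω} (hμ : μ ≠ 0)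
    {f : Ω → ℝ} (hf : ∀ x, 0 < f x) (hfi : Integrable f μ) : 0 < ∫ x, f x ∂μ := by
  rw [integral_pos_iff_support_of_nonneg (fun x => (hf x).le) hfi]
  have : Function.support f = Set.univ := Set.eq_univ_of_forall fun x => (hf x).ne'
  rw [this]
  exact Measure.measure_univ_pos.2 hμ

/-- Weighted integrals of the translates of a `C¹` function may be differentiated under the
integral sign when the function and its derivative are locally uniformly dominated. -/
theorem hasDerivAt_integral_comp_add_mul {Ω : Type*} [MeasurableSpace Ω] {μ : Measure Ω}
    {F : ℝ → ℝ} (hF : ContDiff ℝ 1 F) {u w g : Ω → ℝ} (hu : Measurable u) (hw : Measurable w)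
    (hw_nonneg : ∀ x, 0 ≤ w x) {t₀ ε : ℝ} (hε : 0 < ε)
    (hg : Integrable (fun x => g x * w x) μ)
    (hFg : ∀ x t, |t - t₀| < ε → |F (u x + t)| ≤ g x)
    (hF'g : ∀ x t, |t - t₀| < ε → |deriv F (u x + t)| ≤ g x) :
    Integrable (fun x => F (u x + t₀) * w x) μ ∧
      Integrable (fun x => deriv F (u x + t₀) * w x) μ ∧
      HasDerivAt (fun t => ∫ x, F (u x + t) * w x ∂μ) (∫ x, deriv F (u x + t₀) * w x ∂μ) t₀ := by
  have hF_meas (t : ℝ) : Measurable fun x => F (u x + t) * w x :=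
    (hF.continuous.measurable.comp (hu.add_const t)).mul hw
  have hF'_meas : Measurable fun x => deriv F (u x + t₀) * w x :=
    ((hF.continuous_deriv le_rfl).measurable.comp (hu.add_const t₀)).mul hw
  have norm_mul_le {a : ℝ} {x : Ω} (ha : |a| ≤ g x) : ‖a * w x‖ ≤ g x * w x := by
    rw [Real.norm_eq_abs, abs_mul, abs_of_nonneg (hw_nonneg x)]
    exact mul_le_mul_of_nonneg_right ha (hw_nonneg x)
  have hF_int : Integrable (fun x => F (u x + t₀) * w x) μ :=
    hg.mono' (hF_meas t₀).aestronglyMeasurable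
      (.of_forall fun x => norm_mul_le (hFg x t₀ (by simpa using hε)))
  refine ⟨hF_int, hasDerivAt_integral_of_dominated_loc_of_deriv_le
    (F' := fun t x => deriv F (u x + t) * w x) (Metric.ball_mem_nhds t₀ hε)
    (.of_forall fun t => (hF_meas t).aestronglyMeasurable) hF_int
    hF'_meas.aestronglyMeasurable
    (.of_forall fun x t ht => norm_mul_le (hF'g x t (by simpa [Real.dist_eq] using ht))) hg
    (.of_forall fun x t _ => ?_)⟩
  exact ((hF.differentiable one_ne_zero _).hasDerivAt.comp_const_add (u x) t).mul_const (w x)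

/-- A function with positive second derivative lies strictly above its tangent line at `0`. -/
theorem add_mul_deriv_zero_lt {B B' B'' : ℝ → ℝ} (hB : ∀ t, HasDerivAt B (B' t) t)
    (hB' : ∀ t, HasDerivAt B' (B'' t) t) (hB'' : ∀ t, 0 < B'' t) {t : ℝ} (ht : t ≠ 0) :
    B 0 + t * B' 0 < B t := by
  have hconv : StrictConvexOn ℝ Set.univ B := by
    refine strictConvexOn_univ_of_deriv2_pos
      (continuous_iff_continuousAt.2 fun t => (hB t).continuousAt) fun t => ?_
    have : deriv B = B' := funext fun t => (hB t).deriv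
    simpa [this, (hB' t).deriv] using hB'' t
  rcases ht.lt_or_gt with h | h
  · have := hconv.slope_lt_of_hasDerivAt (Set.mem_univ t) (Set.mem_univ 0) h (hB 0)
    rw [slope_def_field, div_lt_iff₀ (by linarith)] at this
    linarith
  · have := hconv.lt_slope_of_hasDerivAt (Set.mem_univ 0) (Set.mem_univ t) h (hB 0)
    rw [slope_def_field, lt_div_iff₀ (by linarith)] at this
    linarith

theorem hasDerivAt_const_add_sum_update {ι : Type*} [Fintype ι] [DecidableEq ι] (k : ℝ)
    {G : ι → ℝ → ℝ} (a : ι → ℝ) {i : ι} {t d : ℝ} (hG : HasDerivAt (G i) d t) :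
    HasDerivAt (fun s => k + ∑ j, G j (Function.update a i s j)) d t := by
  have hsum (s : ℝ) : k + ∑ j, G j (Function.update a i s j) =
      (k + ∑ j ∈ Finset.univ.erase i, G j (a j)) + G i s := by
    rw [← Finset.add_sum_erase _ _ (Finset.mem_univ i), Function.update_self,
      Finset.sum_congr rfl fun j hj => by
        rw [Function.update_of_ne (Finset.ne_of_mem_erase hj)]]
    ring
  simp only [hsum]
  exact hG.const_add _

/-- Under the stated domination hypotheses, the Hessian of `h` is diagonal with
`∂²h(α)/∂αᵢ² = −∫ b''(ηᵢ(γ) + αᵢ) φ(γ; 0, D) dγ < 0` and vanishing mixed partials;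
in particular the Hessian is negative definite everywhere and `α = 0` is the unique
maximizer of `h`, i.e. `h(0) > h(α)` for all `α ≠ 0`. -/
theorem stmt_12 (n p r : ℕ) (hn : 0 < n) (hp : 0 < p) (hr : 0 < r)
    (X : Matrix (Fin n) (Fin p) ℝ) (Z : Matrix (Fin n) (Fin r) ℝ)
    (β : Fin p → ℝ) (D : Matrix (Fin r) (Fin r) ℝ) (hD : D.PosDef)
    (η : (Fin r → ℝ) → Fin n → ℝ) (hη : ∀ γ, η γ = X *ᵥ β + Z *ᵥ γ)
    (b : ℝ → ℝ) (hb : ContDiff ℝ 2 b) (hb'' : ∀ t, 0 < deriv (deriv b) t)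
    (ν : Measure (Fin n → ℝ)) [SigmaFinite ν] (c : ℝ → ℝ)
    (f : (Fin n → ℝ) → (Fin r → ℝ) → ℝ)
    (hf : ∀ y γ, f y γ =
      Real.exp (y ⬝ᵥ η γ - ∑ i, b (η γ i) + ∑ i, c (y i)))
    (hfprob : ∀ γ, ∫ y, f y γ ∂ν = 1)
    (hfint : ∀ γ, Integrable (fun y => f y γ) ν)
    (hfmean : ∀ γ i, ∫ y, y i * f y γ ∂ν = deriv b (η γ i))
    (hfmean_int : ∀ γ i, Integrable (fun y => y i * f y γ) ν)
    (fα : (Fin n → ℝ) → (Fin n → ℝ) → (Fin r → ℝ) → ℝ)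
    (hfα : ∀ α y γ, fα α y γ =
      Real.exp (y ⬝ᵥ (η γ + α) - ∑ i, b (η γ i + α i) + ∑ i, c (y i)))
    (h : (Fin n → ℝ) → ℝ)
    (hh : ∀ α, h α =
      ∫ γ, (∫ y, Real.log (fα α y γ * gauss γ 0 D) * f y γ ∂ν) * gauss γ 0 D)
    -- domination hypotheses: locally uniform `N(0, D)`-integrable bounds for
    -- `b`, `b'`, `b''` composed with shifted linear components:
    (hdom : ∀ (α : Fin n → ℝ) (i : Fin n), ∃ ε > 0, ∃ g : (Fin r → ℝ) → ℝ,
      Integrable (fun γ : Fin r → ℝ => g γ * gauss γ 0 D) ∧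
        ∀ (γ : Fin r → ℝ) (t : ℝ), |t - α i| < ε →
          |b (η γ i + t)| ≤ g γ ∧ |deriv b (η γ i + t)| ≤ g γ ∧
            |deriv (deriv b) (η γ i + t)| ≤ g γ)
    -- all relevant integrals are finite:
    (hfin_inner : ∀ α γ,
      Integrable (fun y => Real.log (fα α y γ * gauss γ 0 D) * f y γ) ν)
    (hfin_outer : ∀ α, Integrable (fun γ : Fin r → ℝ =>
      (∫ y, Real.log (fα α y γ * gauss γ 0 D) * f y γ ∂ν) * gauss γ 0 D)) :
    ∀ α : Fin n → ℝ,
      (∀ i, deriv (deriv (fun t => h (Function.update α i t))) (α i) =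
          -∫ γ, deriv (deriv b) (η γ i + α i) * gauss γ 0 D) ∧
      (∀ i, deriv (deriv (fun t => h (Function.update α i t))) (α i) < 0) ∧
      (∀ i j, i ≠ j →
        deriv (fun s =>
          deriv (fun t => h (Function.update (Function.update α j s) i t)) (α i))
          (α j) = 0) ∧
      (α ≠ 0 → h α < h 0) := by
  have hw_pos (γ : Fin r → ℝ) : 0 < gauss γ 0 D := gauss_pos γ 0 hD
  have hw : Measurable fun γ : Fin r → ℝ => gauss γ 0 D := (continuous_gauss 0 D).measurable
  have hu (i : Fin n) : Measurable fun γ => η γ i := by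
    have : Continuous fun γ => η γ i := by
      simp only [hη, Pi.add_apply, mulVec, dotProduct]
      fun_prop
    exact this.measurable
  have hb' : ContDiff ℝ 1 (deriv b) := hb.deriv'
  have hB (i : Fin n) (t : ℝ) :
      Integrable (fun γ => b (η γ i + t) * gauss γ 0 D) ∧
        Integrable (fun γ => deriv b (η γ i + t) * gauss γ 0 D) ∧
        HasDerivAt (fun t => ∫ γ, b (η γ i + t) * gauss γ 0 D)
          (∫ γ, deriv b (η γ i + t) * gauss γ 0 D) t := by
    obtain ⟨ε, hε, g, hg, hbd⟩ := hdom (fun _ => t) i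
    exact hasDerivAt_integral_comp_add_mul (hb.of_le one_le_two) (hu i) hw
      (fun γ => (hw_pos γ).le) hε hg (fun γ s hs => (hbd γ s hs).1)
      (fun γ s hs => (hbd γ s hs).2.1)
  have hB' (i : Fin n) (t : ℝ) :
      Integrable (fun γ => deriv b (η γ i + t) * gauss γ 0 D) ∧
        Integrable (fun γ => deriv (deriv b) (η γ i + t) * gauss γ 0 D) ∧
        HasDerivAt (fun t => ∫ γ, deriv b (η γ i + t) * gauss γ 0 D)
          (∫ γ, deriv (deriv b) (η γ i + t) * gauss γ 0 D) t := by
    obtain ⟨ε, hε, g, hg, hbd⟩ := hdom (fun _ => t) i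
    exact hasDerivAt_integral_comp_add_mul hb' (hu i) hw
      (fun γ => (hw_pos γ).le) hε hg (fun γ s hs => (hbd γ s hs).2.1)
      (fun γ s hs => (hbd γ s hs).2.2)
  have hB''_pos (i : Fin n) (t : ℝ) :
      0 < ∫ γ, deriv (deriv b) (η γ i + t) * gauss γ 0 D :=
    integral_pos_of_pos (NeZero.ne volume)
      (fun γ => mul_pos (hb'' _) (hw_pos γ)) (hB' i t).2.1
  set B : Fin n → ℝ → ℝ := fun i t => ∫ γ, b (η γ i + t) * gauss γ 0 D with hB_def
  set B' : Fin n → ℝ → ℝ := fun i t => ∫ γ, deriv b (η γ i + t) * gauss γ 0 D with hB'_def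
  set B'' : Fin n → ℝ → ℝ :=
    fun i t => ∫ γ, deriv (deriv b) (η γ i + t) * gauss γ 0 D
  set G : Fin n → ℝ → ℝ := fun i t => t * B' i 0 - (B i t - B i 0) with hG_def
  have hinner (α : Fin n → ℝ) (γ : Fin r → ℝ) :
      (∫ y, Real.log (fα α y γ * gauss γ 0 D) * f y γ ∂ν) -
          ∫ y, Real.log (fα 0 y γ * gauss γ 0 D) * f y γ ∂ν =
        ∑ i, (α i * deriv b (η γ i) - (b (η γ i + α i) - b (η γ i))) := by
    rw [← integral_sub (hfin_inner α γ) (hfin_inner 0 γ)]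
    have hpt (y : Fin n → ℝ) :
        Real.log (fα α y γ * gauss γ 0 D) * f y γ - Real.log (fα 0 y γ * gauss γ 0 D) * f y γ =
          ∑ i, (α i * (y i * f y γ) - (b (η γ i + α i) - b (η γ i)) * f y γ) := by
      rw [hfα, hfα, Real.log_mul (Real.exp_ne_zero _) (hw_pos γ).ne',
        Real.log_mul (Real.exp_ne_zero _) (hw_pos γ).ne', Real.log_exp, Real.log_exp]
      simp only [← mul_assoc, ← sub_mul, ← Finset.sum_mul, Finset.sum_sub_distrib,
        dotProduct_add, Pi.zero_apply, add_zero]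
      have : y ⬝ᵥ α = ∑ i, α i * y i := dotProduct_comm y α
      rw [this]
      ring
    have hsummand (i : Fin n) : Integrable (fun y =>
        α i * (y i * f y γ) - (b (η γ i + α i) - b (η γ i)) * f y γ) ν :=
      ((hfmean_int γ i).const_mul _).sub ((hfint γ).const_mul _)
    simp only [hpt]
    rw [integral_finsetSum _ fun i _ => hsummand i]
    refine Finset.sum_congr rfl fun i _ => ?_
    rw [integral_sub ((hfmean_int γ i).const_mul _) ((hfint γ).const_mul _),
      integral_const_mul, integral_const_mul, hfmean, hfprob, mul_one]
  have hsep (α : Fin n → ℝ) : h α = h 0 + ∑ i, G i (α i) := by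
    rw [← sub_eq_iff_eq_add', hh, hh, ← integral_sub (hfin_outer α) (hfin_outer 0)]
    simp only [← sub_mul, hinner, Finset.sum_mul]
    have hb0 (i : Fin n) : Integrable fun γ => b (η γ i) * gauss γ 0 D := by
      simpa using (hB i 0).1
    have hb'0 (i : Fin n) : Integrable fun γ => deriv b (η γ i) * gauss γ 0 D := by
      simpa using (hB' i 0).1
    have hsplit (i : Fin n) (γ : Fin r → ℝ) :
        (α i * deriv b (η γ i) - (b (η γ i + α i) - b (η γ i))) * gauss γ 0 D =
          α i * (deriv b (η γ i) * gauss γ 0 D) -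
            (b (η γ i + α i) * gauss γ 0 D - b (η γ i) * gauss γ 0 D) := by
      ring
    simp only [hsplit]
    have hsub_integrable (i : Fin n) : Integrable fun γ =>
        b (η γ i + α i) * gauss γ 0 D - b (η γ i) * gauss γ 0 D :=
      (hB i (α i)).1.sub (hb0 i)
    have hsummand (i : Fin n) : Integrable fun γ => α i * (deriv b (η γ i) * gauss γ 0 D) -
        (b (η γ i + α i) * gauss γ 0 D - b (η γ i) * gauss γ 0 D) :=
      ((hb'0 i).const_mul _).sub (hsub_integrable i)
    rw [integral_finsetSum _ fun i _ => hsummand i]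
    refine Finset.sum_congr rfl fun i _ => ?_
    rw [integral_sub ((hb'0 i).const_mul _) (hsub_integrable i),
      integral_sub (hB i (α i)).1 (hb0 i), integral_const_mul]
    simp [hG_def, hB_def, hB'_def]
  have hG (i : Fin n) (t : ℝ) : HasDerivAt (G i) (B' i 0 - B' i t) t := by
    have hd := ((hasDerivAt_id t).mul_const (B' i 0)).sub ((hB i t).2.2.sub_const (B i 0))
    rw [one_mul] at hd
    exact hd
  have hderiv (α : Fin n → ℝ) (i : Fin n) (t : ℝ) :
      deriv (fun s => h (Function.update α i s)) t = B' i 0 - B' i t := by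
    simp only [hsep (Function.update _ _ _)]
    exact (hasDerivAt_const_add_sum_update (h 0) α (hG i t)).deriv
  have hderiv2 (α : Fin n → ℝ) (i : Fin n) (t : ℝ) :
      deriv (deriv fun s => h (Function.update α i s)) t = -B'' i t := by
    rw [funext (hderiv α i)]
    exact ((hB' i t).2.2.const_sub (B' i 0)).deriv
  intro α
  refine ⟨fun i => hderiv2 α i (α i), fun i => ?_, fun i j _ => ?_, fun hα => ?_⟩
  · rw [hderiv2]
    exact neg_neg_of_pos (hB''_pos i (α i))
  · simp only [hderiv, deriv_const]
  · have hG_neg (i : Fin n) (hi : α i ≠ 0) : G i (α i) < 0 := by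
      have := add_mul_deriv_zero_lt (fun t => (hB i t).2.2) (fun t => (hB' i t).2.2)
        (hB''_pos i) hi
      simp only [hG_def, hB_def, hB'_def] at this ⊢
      linarith
    obtain ⟨k, hk⟩ := Function.ne_iff.1 hα
    have hlt : ∑ i, G i (α i) < 0 := by
      refine Finset.sum_neg' (fun i _ => ?_) ⟨k, Finset.mem_univ k, hG_neg k hk⟩
      rcases eq_or_ne (α i) 0 with hi | hi
      · simp [hG_def, hi]
      · exact (hG_neg i hi).le
    rw [hsep α]
    linarith
end
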